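/- For every k ≥ 1 there exists a set S of 2k+3 points in general position in ℝ^(2k) such that for every (k+1)-element subset I ⊆ S, the k-simplex conv I intersects the boundary of the (k+1)-simplex conv(S \ I) (the union of the convex hulls of the (k+1)-element subsets of S \ I) in a finite, even number of points. -/

import Mathlib

open scoped Classical

/-- A finite set of points in `ℝ^d` is in general position if every
`(d+1)`-element subset of it is affinely independent. -/
def GenPos (d : ℕ) (S : Finset (Fin d → ℝ)) : Prop :=
  ∀ T ⊆ S, T.card = d + 1 →
    AffineIndependent ℝ (fun x : (T : Set (Fin d → ℝ)) => (x : Fin d → ℝ))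

/-- The boundary of the simplex with vertex set `B`: the union of the convex
hulls of the `m`-element subsets of `B`. -/
def simplexBoundary (d m : ℕ) (B : Finset (Fin d → ℝ)) : Set (Fin d → ℝ) :=
  ⋃ Y ∈ B.powersetCard m, convexHull ℝ (Y : Set (Fin d → ℝ))

/-- The weights `w` form an affine dependency of the family `f`. -/
def IsAffineDependency {ι V : Type*} [Fintype ι] [AddCommGroup V] [Module ℝ V]
    (f : ι → V) (w : ι → ℝ) : Prop :=
  ∑ i, w i = 0 ∧ ∑ i, w i • f i = 0

namespace IsAffineDependency

variable {ι V : Type*} [Fintype ι] [AddCommGroup V] [Module ℝ V] {f : ι → V} {v w : ι → ℝ}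

lemma sub (hv : IsAffineDependency f v) (hw : IsAffineDependency f w) :
    IsAffineDependency f (fun i => v i - w i) := by
  constructor
  · simp [hv.1, hw.1]
  · simp [sub_smul, hv.2, hw.2]

lemma smul (c : ℝ) (hw : IsAffineDependency f w) : IsAffineDependency f (fun i => c * w i) := by
  constructor
  · simp [← Finset.mul_sum, hw.1]
  · simp [mul_smul, ← Finset.smul_sum, hw.2]

end IsAffineDependency

lemma isAffineDependency_of_sum_eq {ι V : Type*} [Fintype ι] [AddCommGroup V] [Module ℝ V]
    {f : ι → V} {a b : ι → ℝ} {z : V} (ha : ∑ i, a i = 1) (hb : ∑ i, b i = 1)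
    (haz : ∑ i, a i • f i = z) (hbz : ∑ i, b i • f i = z) :
    IsAffineDependency f (fun i => a i - b i) := by
  constructor
  · simp [ha, hb]
  · simp [sub_smul, haz, hbz]

lemma mem_convexHull_image_iff {ι V : Type*} [Fintype ι] [AddCommGroup V] [Module ℝ V]
    [DecidableEq V] {f : ι → V} (hf : Function.Injective f) (U : Finset ι) (z : V) :
    z ∈ convexHull ℝ ((U.image f : Finset V) : Set V) ↔
      ∃ a : ι → ℝ, (∀ i, 0 ≤ a i) ∧ (∀ i ∉ U, a i = 0) ∧ ∑ i, a i = 1 ∧ ∑ i, a i • f i = z := by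
  rw [Finset.mem_convexHull']
  constructor
  · rintro ⟨w, h0, h1, h2⟩
    rw [Finset.sum_image hf.injOn] at h1 h2
    refine ⟨fun i => if i ∈ U then w (f i) else 0, fun i => ?_, fun i hi => if_neg hi, ?_, ?_⟩
    · dsimp only
      split_ifs with hi
      · exact h0 _ (Finset.mem_image_of_mem f hi)
      · exact le_rfl
    · simpa using h1
    · simpa [ite_smul] using h2
  · rintro ⟨a, h0, h1, h2, h3⟩
    refine ⟨Function.extend f a 0, fun y hy => ?_, ?_, ?_⟩
    · obtain ⟨i, -, rfl⟩ := Finset.mem_image.1 hy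
      rw [hf.extend_apply]
      exact h0 i
    · rw [Finset.sum_image hf.injOn, ← h2]
      simp only [hf.extend_apply]
      exact Finset.sum_subset (Finset.subset_univ U) fun i _ hi => h1 i hi
    · rw [Finset.sum_image hf.injOn, ← h3]
      simp only [hf.extend_apply]
      exact Finset.sum_subset (Finset.subset_univ U) fun i _ hi => by rw [h1 i hi, zero_smul]

/-- The points with parameters `0, 1, …, d + 2` on the moment curve in `ℝ^d`. -/
def momentPoint (d : ℕ) (i : Fin (d + 3)) : Fin d → ℝ := fun j => (i : ℝ) ^ (j.val + 1)

lemma momentPoint_injective {d : ℕ} (hd : 0 < d) : Function.Injective (momentPoint d) := by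
  intro i j h
  have := congrFun h ⟨0, hd⟩
  simp only [momentPoint, zero_add, pow_one, Nat.cast_inj] at this
  exact Fin.ext this

lemma isAffineDependency_momentPoint_iff {d : ℕ} {w : Fin (d + 3) → ℝ} :
    IsAffineDependency (momentPoint d) w ↔
      ∀ m ≤ d, ∑ i, w i * (i : ℝ) ^ m = 0 := by
  constructor
  · rintro ⟨h0, h1⟩ m hm
    rcases m with _ | m
    · simpa using h0
    · simpa [momentPoint] using congrFun h1 ⟨m, hm⟩
  · intro h
    refine ⟨by simpa using h 0 (Nat.zero_le d), ?_⟩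
    ext j
    simpa [momentPoint] using h (j + 1) j.isLt

lemma IsAffineDependency.sum_mul_eval {d : ℕ} {w : Fin (d + 3) → ℝ}
    (hw : IsAffineDependency (momentPoint d) w) {p : Polynomial ℝ} (hp : p.natDegree ≤ d) :
    ∑ i, w i * p.eval (i : ℝ) = 0 := by
  simp_rw [Polynomial.eval_eq_sum_range' (Nat.lt_succ_of_le hp), Finset.mul_sum]
  rw [Finset.sum_comm]
  refine Finset.sum_eq_zero fun m hm => ?_
  have := isAffineDependency_momentPoint_iff.1 hw m (Nat.lt_succ_iff.1 (Finset.mem_range.1 hm))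
  calc ∑ i, w i * (p.coeff m * (i : ℝ) ^ m)
      = p.coeff m * ∑ i, w i * (i : ℝ) ^ m := by
        rw [Finset.mul_sum]
        exact Finset.sum_congr rfl fun i _ => mul_left_comm _ _ _
    _ = 0 := by rw [this, mul_zero]

/-- Any `d + 1` of the points on the moment curve are affinely independent. -/
lemma IsAffineDependency.eq_zero {d : ℕ} {w : Fin (d + 3) → ℝ}
    (hw : IsAffineDependency (momentPoint d) w) {x y : Fin (d + 3)} (hxy : x ≠ y)
    (hx : w x = 0) (hy : w y = 0) (i : Fin (d + 3)) : w i = 0 := by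
  by_cases hix : i = x
  · rw [hix, hx]
  by_cases hiy : i = y
  · rw [hiy, hy]
  set s : Finset (Fin (d + 3)) := {i, x, y} with hs
  have hcard : s.card = 3 := Finset.card_eq_three.2 ⟨i, x, y, hix, hiy, hxy, rfl⟩
  set p : Polynomial ℝ := ∏ j ∈ sᶜ, (Polynomial.X - Polynomial.C (j : ℝ)) with hp
  have hdeg : p.natDegree ≤ d := by
    rw [hp, Polynomial.natDegree_finsetProd_X_sub_C_eq_card, Finset.card_compl, hcard]
    simp
  have hsum := hw.sum_mul_eval hdeg
  rw [Finset.sum_eq_single i] at hsum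
  · refine (mul_eq_zero.1 hsum).resolve_right ?_
    rw [hp, Polynomial.eval_prod]
    refine Finset.prod_ne_zero_iff.2 ?_
    intro j hj
    have hji : i ≠ j := by
      rintro rfl
      simp [hs] at hj
    simpa [sub_eq_zero, Fin.ext_iff] using hji
  · intro j _ hji
    by_cases hj : j ∈ s
    · simp only [hs, Finset.mem_insert, Finset.mem_singleton] at hj
      rcases hj with rfl | rfl | rfl
      · exact absurd rfl hji
      · rw [hx, zero_mul]
      · rw [hy, zero_mul]
    · rw [hp, Polynomial.eval_prod, Finset.prod_eq_zero (Finset.mem_compl.2 hj) (by simp),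
        mul_zero]
  · simp

/-- The affine dependency among the points on the moment curve other than the `x`-th one. -/
def momentDependency (d : ℕ) (x i : Fin (d + 3)) : ℝ :=
  (-1) ^ (d + 2 - i.val) * ((d + 2).choose i : ℝ) * ((i : ℝ) - x)

lemma momentDependency_self (d : ℕ) (x : Fin (d + 3)) : momentDependency d x x = 0 := by
  simp [momentDependency]

lemma isAffineDependency_momentDependency (d : ℕ) (x : Fin (d + 3)) :
    IsAffineDependency (momentPoint d) (momentDependency d x) := by
  rw [isAffineDependency_momentPoint_iff]
  intro m hm
  set p : Polynomial ℝ := (Polynomial.X - Polynomial.C (x : ℝ)) * Polynomial.X ^ m with hp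
  have hdeg : p.natDegree < d + 2 := by
    refine lt_of_le_of_lt Polynomial.natDegree_mul_le ?_
    rw [Polynomial.natDegree_X_sub_C, Polynomial.natDegree_X_pow]
    omega
  have h := congrFun (Polynomial.fwdDiff_iter_eq_zero_of_degree_lt hdeg) 0
  rw [fwdDiff_iter_eq_sum_shift, ← Fin.sum_univ_eq_sum_range
    (fun i => ((-1 : ℤ) ^ (d + 2 - i) * (d + 2).choose i) • p.eval ((0 : ℝ) + i • 1))] at h
  rw [Pi.zero_apply] at h
  rw [← h]
  refine Finset.sum_congr rfl fun i _ => ?_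
  simp only [momentDependency, hp, zsmul_eq_mul, nsmul_eq_mul, Polynomial.eval_mul,
    Polynomial.eval_sub, Polynomial.eval_X, Polynomial.eval_C, Polynomial.eval_pow]
  push_cast
  ring

/-- The sign pattern of `momentDependency` when `d` is even. -/
lemma momentDependency_eq {d : ℕ} (hd : Even d) (x i : Fin (d + 3)) :
    ∃ c : ℝ, 0 < c ∧ momentDependency d x i =
      (if Even i.val then 1 else -1) * c * ((i : ℝ) - x) := by
  refine ⟨(d + 2).choose i, by exact_mod_cast Nat.choose_pos (by omega), ?_⟩
  have hi : i.val ≤ d + 2 := by omega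
  have : Even (d + 2 - i.val) ↔ Even i.val := by
    rw [Nat.even_sub hi, Nat.even_add]
    simp [hd]
  rw [momentDependency, neg_one_pow_eq_ite]
  simp only [this]

lemma momentDependency_pos_iff {d : ℕ} (hd : Even d) (x i : Fin (d + 3)) :
    0 < momentDependency d x i ↔ (x < i ∧ Even i.val) ∨ (i < x ∧ ¬ Even i.val) := by
  obtain ⟨c, hc, h⟩ := momentDependency_eq hd x i
  rw [h]
  have hlt : (x < i) ↔ (0 : ℝ) < (i : ℝ) - x := by rw [sub_pos, Nat.cast_lt, Fin.lt_def]
  have hgt : (i < x) ↔ (i : ℝ) - x < 0 := by rw [sub_neg, Nat.cast_lt, Fin.lt_def]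
  rw [hlt, hgt]
  split_ifs with he
  · simp [he, hc]
  · simp only [he, neg_mul, neg_pos]
    simp [mul_neg_iff, hc, hc.not_gt]

lemma momentDependency_neg_iff {d : ℕ} (hd : Even d) (x i : Fin (d + 3)) :
    momentDependency d x i < 0 ↔ (x < i ∧ ¬ Even i.val) ∨ (i < x ∧ Even i.val) := by
  obtain ⟨c, hc, h⟩ := momentDependency_eq hd x i
  rw [h]
  have hlt : (x < i) ↔ (0 : ℝ) < (i : ℝ) - x := by rw [sub_pos, Nat.cast_lt, Fin.lt_def]
  have hgt : (i < x) ↔ (i : ℝ) - x < 0 := by rw [sub_neg, Nat.cast_lt, Fin.lt_def]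
  rw [hlt, hgt]
  split_ifs with he
  · simp [he, hc, mul_neg_iff, hc.not_gt]
  · simp [he, hc]

lemma momentDependency_ne_zero {d : ℕ} (hd : Even d) {x i : Fin (d + 3)} (h : i ≠ x) :
    momentDependency d x i ≠ 0 := by
  have h1 := momentDependency_pos_iff hd x i
  have h2 := momentDependency_neg_iff hd x i
  rcases lt_or_gt_of_ne h with h | h <;> by_cases he : Even i.val
  · exact (h2.2 (Or.inr ⟨h, he⟩)).ne
  · exact (h1.2 (Or.inr ⟨h, he⟩)).ne'
  · exact (h1.2 (Or.inl ⟨h, he⟩)).ne'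
  · exact (h2.2 (Or.inl ⟨h, he⟩)).ne

lemma IsAffineDependency.eq_mul_momentDependency {d : ℕ} (hd : Even d) {w : Fin (d + 3) → ℝ}
    (hw : IsAffineDependency (momentPoint d) w) {x : Fin (d + 3)} (hx : w x = 0) :
    ∃ c : ℝ, ∀ i, w i = c * momentDependency d x i := by
  obtain ⟨y, hy⟩ := exists_ne x
  have hne := momentDependency_ne_zero hd hy
  refine ⟨w y / momentDependency d x y, fun i => ?_⟩
  have := (hw.sub ((isAffineDependency_momentDependency d x).smul
    (w y / momentDependency d x y))).eq_zero (x := x) (y := y) hy.symm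
    (by simp [hx, momentDependency_self]) (by field_simp; ring) i
  linarith

lemma genPos_momentPoint {d : ℕ} (hd : 0 < d) :
    GenPos d (Finset.univ.image (momentPoint d)) := by
  intro T hT hcard
  have hf := momentPoint_injective hd
  obtain ⟨U, -, rfl⟩ := Finset.subset_image_iff.1 hT
  rw [Finset.card_image_of_injective _ hf] at hcard
  have h2 : 1 < Uᶜ.card := by
    rw [Finset.card_compl, hcard, Fintype.card_fin]
    omega
  obtain ⟨x, hx, y, hy, hxy⟩ := Finset.one_lt_card.1 h2
  rw [Finset.mem_compl] at hx hy
  have key : AffineIndependent ℝ (fun u : U => momentPoint d u) := by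
    rw [affineIndependent_iff]
    intro s w h0 h1 e he
    set v : Fin (d + 3) → ℝ := fun i => if h : i ∈ U then (if ⟨i, h⟩ ∈ s then w ⟨i, h⟩ else 0) else 0
      with hv
    have hdep : IsAffineDependency (momentPoint d) v := by
      have hz : ∀ i ∉ U, v i = 0 := fun i hi => dif_neg hi
      have hval : ∀ u : U, v u = if u ∈ s then w u else 0 := fun u => by simp [hv]
      constructor
      · rw [← Finset.sum_subset (Finset.subset_univ U) fun i _ hi => hz i hi,
          ← Finset.sum_coe_sort U]
        simpa only [hval, Finset.sum_ite_mem, Finset.univ_inter] using h0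
      · rw [← Finset.sum_subset (Finset.subset_univ U) fun i _ hi => by rw [hz i hi, zero_smul],
          ← Finset.sum_coe_sort U]
        simpa only [hval, ite_smul, zero_smul, Finset.sum_ite_mem, Finset.univ_inter] using h1
    have := hdep.eq_zero hxy (dif_neg hx) (dif_neg hy) e
    simpa [hv, he] using this
  have hrange : Set.range (fun u : U => momentPoint d u) =
      ((U.image (momentPoint d) : Finset _) : Set (Fin d → ℝ)) := by
    ext z
    simp
  have := key.range
  rwa [hrange] at this

/-- After deleting `x`, membership in `J` alternates along the remaining indices. -/
def AlternatesOff {n : ℕ} (J : Finset (Fin n)) (x : Fin n) : Prop :=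
  ((∀ i < x, (i ∈ J ↔ Even i.val)) ∧ ∀ i, x < i → ¬ (i ∈ J ↔ Even i.val)) ∨
    ((∀ i < x, ¬ (i ∈ J ↔ Even i.val)) ∧ ∀ i, x < i → (i ∈ J ↔ Even i.val))

lemma alternatesOff_iff_of_step {n : ℕ} {J : Finset (Fin n)} {a b : Fin n}
    (hab : a.val + 1 = b.val) {s : Prop} (ha : ∀ i ≤ a, ((i ∈ J ↔ Even i.val) ↔ s))
    (hb : ∀ i, b ≤ i → ((i ∈ J ↔ Even i.val) ↔ ¬ s)) (z : Fin n) :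
    AlternatesOff J z ↔ z = a ∨ z = b := by
  have ha' := ha a le_rfl
  have hb' := hb b le_rfl
  constructor
  · intro h
    by_contra! hz
    have hz' : (z < a ∧ z < b) ∨ (a < z ∧ b < z) := by
      simp only [Fin.lt_def]
      have h1 := Fin.val_ne_of_ne hz.1
      have h2 := Fin.val_ne_of_ne hz.2
      omega
    rcases hz' with hz' | hz' <;> rcases h with h | h
    · have := h.2 a hz'.1
      have := h.2 b hz'.2
      tauto
    · have := h.2 a hz'.1
      have := h.2 b hz'.2
      tauto
    · have := h.1 a hz'.1
      have := h.1 b hz'.2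
      tauto
    · have := h.1 a hz'.1
      have := h.1 b hz'.2
      tauto
  · intro hz
    have hlow : ∀ i < z, i ≤ a := fun i hi => by
      rcases hz with rfl | rfl <;> simp only [Fin.lt_def, Fin.le_def] at * <;> omega
    have hhigh : ∀ i, z < i → b ≤ i := fun i hi => by
      rcases hz with rfl | rfl <;> simp only [Fin.lt_def, Fin.le_def] at * <;> omega
    by_cases hs : s
    · exact Or.inl ⟨fun i hi => (ha i (hlow i hi)).2 hs,
        fun i hi h => (hb i (hhigh i hi)).1 h hs⟩
    · exact Or.inr ⟨fun i hi h => hs ((ha i (hlow i hi)).1 h),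
        fun i hi => (hb i (hhigh i hi)).2 hs⟩

lemma alternatesOff_iff_of_const {n : ℕ} {J : Finset (Fin (n + 1))} {s : Prop}
    (h : ∀ i, ((i ∈ J ↔ Even i.val) ↔ s)) (z : Fin (n + 1)) :
    AlternatesOff J z ↔ z = 0 ∨ z = Fin.last n := by
  simp only [AlternatesOff, h]
  constructor
  · intro hz
    by_contra! hne
    have h0 := Fin.pos_of_ne_zero hne.1
    have h1 := Fin.lt_last_iff_ne_last.2 hne.2
    rcases hz with hz | hz
    · exact hz.2 _ h1 (hz.1 _ h0)
    · exact hz.1 _ h0 (hz.2 _ h1)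
  · rintro (rfl | rfl)
    · by_cases hs : s <;> simp [hs]
    · have : ∀ i, ¬ Fin.last n < i := fun i => (Fin.le_last i).not_gt
      by_cases hs : s <;> simp [hs, this]

lemma AlternatesOff.exists_step_or_const {n : ℕ} {J : Finset (Fin (n + 1))} {x : Fin (n + 1)}
    (hx : AlternatesOff J x) :
    (∃ a b : Fin (n + 1), ∃ s : Prop, a.val + 1 = b.val ∧ (x = a ∨ x = b) ∧
      (∀ i ≤ a, ((i ∈ J ↔ Even i.val) ↔ s)) ∧ ∀ i, b ≤ i → ((i ∈ J ↔ Even i.val) ↔ ¬ s)) ∨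
    ∃ s : Prop, ∀ i, ((i ∈ J ↔ Even i.val) ↔ s) := by
  obtain ⟨s, hl, hr⟩ : ∃ s : Prop, (∀ i < x, ((i ∈ J ↔ Even i.val) ↔ s)) ∧
      ∀ i, x < i → ((i ∈ J ↔ Even i.val) ↔ ¬ s) := by
    rcases hx with h | h
    · exact ⟨True, by simpa using h⟩
    · exact ⟨False, by simpa using h⟩
  by_cases hxs : (x ∈ J ↔ Even x.val) ↔ s
  · have hl' : ∀ i ≤ x, ((i ∈ J ↔ Even i.val) ↔ s) := fun i hi => by
      rcases hi.lt_or_eq with hi | rfl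
      exacts [hl i hi, hxs]
    by_cases hlast : x.val + 1 < n + 1
    · exact Or.inl ⟨x, ⟨x.val + 1, hlast⟩, s, rfl, Or.inl rfl, hl', fun i hi =>
        hr i (Fin.lt_def.2 (Nat.lt_of_succ_le hi))⟩
    · exact Or.inr ⟨s, fun i => hl' i (Fin.le_def.2 (by omega))⟩
  · have hr' : ∀ i, x ≤ i → ((i ∈ J ↔ Even i.val) ↔ ¬ s) := fun i hi => by
      rcases hi.lt_or_eq with hi | rfl
      · exact hr i hi
      · tauto
    by_cases hzero : 0 < x.val
    · refine Or.inl ⟨⟨x.val - 1, by omega⟩, x, s, Nat.sub_add_cancel hzero, Or.inr rfl,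
        fun i hi => hl i ?_, hr'⟩
      rw [Fin.le_def] at hi
      rw [Fin.lt_def]
      dsimp only at hi
      omega
    · exact Or.inr ⟨¬ s, fun i => hr' i (Fin.le_def.2 (by omega))⟩

lemma AlternatesOff.exists_partner {m : ℕ} (hm : Even m) {J : Finset (Fin (m + 3))}
    {x : Fin (m + 3)} (hxJ : x ∉ J) (hx : AlternatesOff J x) :
    ∃ y, y ≠ x ∧ ∀ z, (z ∉ J ∧ AlternatesOff J z) ↔ z = x ∨ z = y := by
  rcases hx.exists_step_or_const with ⟨a, b, s, hab, hxab, ha, hb⟩ | ⟨s, h⟩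
  · have hiff := alternatesOff_iff_of_step hab ha hb
    have hne : a ≠ b := by
      rintro rfl
      omega
    have hJ : a ∈ J ↔ b ∈ J := by
      have h1 := ha a le_rfl
      have h2 := hb b le_rfl
      rw [← hab, Nat.even_add_one] at h2
      tauto
    rcases hxab with rfl | rfl
    · refine ⟨b, hne.symm, fun z => ?_⟩
      rw [hiff, and_iff_right_iff_imp]
      rintro (rfl | rfl) <;> tauto
    · refine ⟨a, hne, fun z => ?_⟩
      rw [hiff, or_comm, and_iff_right_iff_imp]
      rintro (rfl | rfl) <;> tauto
  · have hiff := alternatesOff_iff_of_const h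
    have hne : (0 : Fin (m + 3)) ≠ Fin.last (m + 2) := by
      simp [Fin.ext_iff]
    have hJ : (0 : Fin (m + 3)) ∈ J ↔ Fin.last (m + 2) ∈ J := by
      have h1 := h 0
      have h2 := h (Fin.last (m + 2))
      have h3 : Even (Fin.last (m + 2)).val := hm.add even_two
      have h4 : Even (0 : Fin (m + 3)).val := Even.zero
      tauto
    rcases (hiff x).1 hx with rfl | rfl
    · refine ⟨_, hne.symm, fun z => ?_⟩
      rw [hiff, and_iff_right_iff_imp]
      rintro (rfl | rfl) <;> tauto
    · refine ⟨_, hne, fun z => ?_⟩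
      rw [hiff, or_comm, and_iff_right_iff_imp]
      rintro (rfl | rfl) <;> tauto

lemma even_card_alternatesOff {m : ℕ} (hm : Even m) (J : Finset (Fin (m + 3))) :
    Even (Finset.univ.filter fun x => x ∉ J ∧ AlternatesOff J x).card := by
  by_cases h : ∃ x, x ∉ J ∧ AlternatesOff J x
  · obtain ⟨x, hxJ, hx⟩ := h
    obtain ⟨y, hy, hz⟩ := hx.exists_partner hm hxJ
    have : (Finset.univ.filter fun x => x ∉ J ∧ AlternatesOff J x) = {x, y} := by
      ext z
      simp [hz]
    rw [this, Finset.card_pair hy.symm]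
    exact even_two
  · rw [Finset.filter_false_of_mem fun x _ hx => h ⟨x, hx⟩]
    simp

lemma alternatesOff_iff {d : ℕ} (hd : Even d) (J : Finset (Fin (d + 3))) (x : Fin (d + 3)) :
    AlternatesOff J x ↔ ∃ c : ℝ, ∀ i ≠ x, (i ∈ J → 0 < c * momentDependency d x i) ∧
      (i ∉ J → c * momentDependency d x i < 0) := by
  constructor
  · have hp := momentDependency_pos_iff hd x
    have hn := momentDependency_neg_iff hd x
    rintro (⟨h1, h2⟩ | ⟨h1, h2⟩)
    · refine ⟨-1, fun i hi => ?_⟩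
      rw [neg_one_mul, neg_pos, neg_neg_iff_pos, hp, hn]
      rcases lt_or_gt_of_ne hi with hi | hi
      · have := h1 i hi
        have := hi.not_gt
        tauto
      · have := h2 i hi
        have := hi.not_gt
        tauto
    · refine ⟨1, fun i hi => ?_⟩
      rw [one_mul, hp, hn]
      rcases lt_or_gt_of_ne hi with hi | hi
      · have := h1 i hi
        have := hi.not_gt
        tauto
      · have := h2 i hi
        have := hi.not_gt
        tauto
  · rintro ⟨c, hc⟩
    have hp := momentDependency_pos_iff hd x
    have hn := momentDependency_neg_iff hd x
    rcases lt_trichotomy c 0 with h | rfl | h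
    · left
      simp only [mul_pos_iff, mul_neg_iff, h, h.not_gt, hp, hn] at hc
      refine ⟨fun i hi => ?_, fun i hi => ?_⟩
      · have := hc i hi.ne
        have := hi.not_gt
        tauto
      · have := hc i hi.ne'
        have := hi.not_gt
        tauto
    · obtain ⟨y, hy⟩ := exists_ne x
      have := hc y hy
      simp only [zero_mul, lt_irrefl] at this
      tauto
    · right
      simp only [mul_pos_iff_of_pos_left h, mul_neg_iff, h, h.not_gt, hp, hn] at hc
      refine ⟨fun i hi => ?_, fun i hi => ?_⟩
      · have := hc i hi.ne
        have := hi.not_gt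
        tauto
      · have := hc i hi.ne'
        have := hi.not_gt
        tauto

section Intersection

variable {d : ℕ} {J : Finset (Fin (d + 3))} {x : Fin (d + 3)}

/-- The intersection of the face spanned by `J` with the face spanned by the indices outside `J` other than `x`. -/
def faceInter (d : ℕ) (J : Finset (Fin (d + 3))) (x : Fin (d + 3)) : Set (Fin d → ℝ) :=
  convexHull ℝ ((J.image (momentPoint d) : Finset _) : Set (Fin d → ℝ)) ∩
    convexHull ℝ (((Jᶜ.erase x).image (momentPoint d) : Finset _) : Set (Fin d → ℝ))

lemma mem_faceInter_iff (hd0 : 0 < d) {z : Fin d → ℝ} (hx : x ∉ J) :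
    z ∈ faceInter d J x ↔ ∃ w : Fin (d + 3) → ℝ, IsAffineDependency (momentPoint d) w ∧
      w x = 0 ∧ (∀ i ∈ J, 0 ≤ w i) ∧ (∀ i ∉ J, w i ≤ 0) ∧ ∑ i ∈ J, w i = 1 ∧
      ∑ i ∈ J, w i • momentPoint d i = z := by
  have hf := momentPoint_injective hd0
  rw [faceInter, Set.mem_inter_iff, mem_convexHull_image_iff hf, mem_convexHull_image_iff hf]
  constructor
  · rintro ⟨⟨a, ha0, haJ, ha1, haz⟩, b, hb0, hbJ, hb1, hbz⟩
    have hb : ∀ i ∈ J, b i = 0 := fun i hi => hbJ i (by simp [hi])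
    refine ⟨fun i => a i - b i, isAffineDependency_of_sum_eq ha1 hb1 haz hbz, ?_, ?_, ?_, ?_, ?_⟩
    · simp [haJ x hx, hbJ x (by simp)]
    · intro i hi
      simpa [hb i hi] using ha0 i
    · intro i hi
      simpa [haJ i hi] using hb0 i
    · rw [← ha1, ← Finset.sum_subset (Finset.subset_univ J) fun i _ hi => haJ i hi]
      exact Finset.sum_congr rfl fun i hi => by simp only [hb i hi, sub_zero]
    · rw [← haz, ← Finset.sum_subset (Finset.subset_univ J) fun i _ hi => by
        rw [haJ i hi, zero_smul]]
      exact Finset.sum_congr rfl fun i hi => by simp only [hb i hi, sub_zero]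
  · rintro ⟨w, hw, hwx, hpos, hneg, h1, hz⟩
    have e1 := hw.1
    have e2 := hw.2
    rw [← Finset.sum_add_sum_compl J, h1] at e1
    rw [← Finset.sum_add_sum_compl J, hz] at e2
    refine ⟨⟨fun i => if i ∈ J then w i else 0, fun i => ?_, fun i hi => if_neg hi, ?_, ?_⟩,
      fun i => if i ∈ Jᶜ then -w i else 0, fun i => ?_, fun i hi => ?_, ?_, ?_⟩
    · dsimp only
      split_ifs with hi
      · exact hpos i hi
      · exact le_rfl
    · simpa using h1
    · simpa [ite_smul] using hz
    · dsimp only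
      split_ifs with hi
      · simpa using hneg i (Finset.mem_compl.1 hi)
      · exact le_rfl
    · by_cases hix : i = x
      · simp [hix, hwx]
      · have : i ∈ J := by simpa [hix] using hi
        simp [this]
    · simp only [Finset.sum_ite_mem, Finset.univ_inter, Finset.sum_neg_distrib]
      linarith
    · simp only [ite_smul, zero_smul, Finset.sum_ite_mem, Finset.univ_inter, neg_smul,
        Finset.sum_neg_distrib]
      exact neg_eq_of_add_eq_zero_left e2

lemma faceInter_eq_empty (hd : Even d) (hd0 : 0 < d) (hx : x ∉ J) (h : ¬ AlternatesOff J x) :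
    faceInter d J x = ∅ := by
  rw [Set.eq_empty_iff_forall_notMem]
  intro z hz
  obtain ⟨w, hw, hwx, hpos, hneg, h1, -⟩ := (mem_faceInter_iff hd0 hx).1 hz
  obtain ⟨c, hc⟩ := hw.eq_mul_momentDependency hd hwx
  have hc0 : c ≠ 0 := by
    rintro rfl
    simp [hc] at h1
  refine h ((alternatesOff_iff hd J x).2 ⟨c, fun i hi => ?_⟩)
  have hne := mul_ne_zero hc0 (momentDependency_ne_zero hd hi)
  rw [← hc] at hne ⊢
  exact ⟨fun hJ => (hpos i hJ).lt_of_ne' hne, fun hJ => (hneg i hJ).lt_of_ne hne⟩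

lemma faceInter_subsingleton (hd : Even d) (hd0 : 0 < d) (hx : x ∉ J) :
    (faceInter d J x).Subsingleton := by
  intro z hz z' hz'
  obtain ⟨w, hw, hwx, -, -, h1, rfl⟩ := (mem_faceInter_iff hd0 hx).1 hz
  obtain ⟨w', hw', hwx', -, -, h1', rfl⟩ := (mem_faceInter_iff hd0 hx).1 hz'
  obtain ⟨c, hc⟩ := hw.eq_mul_momentDependency hd hwx
  obtain ⟨c', hc'⟩ := hw'.eq_mul_momentDependency hd hwx'
  simp only [hc, hc', ← Finset.mul_sum] at h1 h1'
  have hcc : c = c' := by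
    refine mul_right_cancel₀ (right_ne_zero_of_mul_eq_one h1) (h1.trans h1'.symm)
  simp only [hc, hc', hcc]

lemma faceInter_nonempty (hd : Even d) (hd0 : 0 < d) (hJ : J.Nonempty) (hx : x ∉ J)
    (h : AlternatesOff J x) : (faceInter d J x).Nonempty := by
  obtain ⟨c, hc⟩ := (alternatesOff_iff hd J x).1 h
  set s := ∑ i ∈ J, c * momentDependency d x i with hs
  have hs0 : 0 < s := Finset.sum_pos (fun i hi => (hc i (by rintro rfl; exact hx hi)).1 hi) hJ
  refine ⟨_, (mem_faceInter_iff hd0 hx).2 ⟨fun i => s⁻¹ * (c * momentDependency d x i),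
    ((isAffineDependency_momentDependency d x).smul c).smul s⁻¹, ?_, ?_, ?_, ?_, rfl⟩⟩
  · simp [momentDependency_self]
  · intro i hi
    exact mul_nonneg (inv_nonneg.2 hs0.le) ((hc i (by rintro rfl; exact hx hi)).1 hi).le
  · intro i hi
    refine mul_nonpos_of_nonneg_of_nonpos (inv_nonneg.2 hs0.le) ?_
    by_cases hix : i = x
    · simp [hix, momentDependency_self]
    · exact ((hc i hix).2 hi).le
  · rw [← Finset.mul_sum, ← hs, inv_mul_cancel₀ hs0.ne']

lemma disjoint_faceInter (hd0 : 0 < d) (hJ : 1 < J.card) {y : Fin (d + 3)}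
    (hx : x ∉ J) (hy : y ∉ J) (hxy : x ≠ y) :
    Disjoint (faceInter d J x) (faceInter d J y) := by
  have hf := momentPoint_injective hd0
  rw [Set.disjoint_left]
  rintro z ⟨hzJ, hzx⟩ ⟨-, hzy⟩
  obtain ⟨a, -, haJ, ha1, haz⟩ := (mem_convexHull_image_iff hf _ _).1 hzJ
  obtain ⟨b, -, hb, hb1, hbz⟩ := (mem_convexHull_image_iff hf _ _).1 hzx
  obtain ⟨b', -, hb', hb1', hbz'⟩ := (mem_convexHull_image_iff hf _ _).1 hzy
  obtain ⟨u, hu, v, hv, huv⟩ := Finset.one_lt_card.1 hJ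
  have hbb := (isAffineDependency_of_sum_eq hb1 hb1' hbz hbz').eq_zero huv
    (by simp [hb u (by simp [hu]), hb' u (by simp [hu])])
    (by simp [hb v (by simp [hv]), hb' v (by simp [hv])])
  have hbx : b x = 0 := hb x (by simp)
  have hby : b y = 0 := by
    have := hbb y
    rw [hb' y (by simp)] at this
    linarith
  have hab := (isAffineDependency_of_sum_eq ha1 hb1 haz hbz).eq_zero hxy
    (by simp [haJ x hx, hbx]) (by simp [haJ y hy, hby])
  have hau : ∀ i, a i = 0 := by
    intro i
    by_cases hi : i ∈ J
    · have := hab i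
      rw [hb i (by simp [hi])] at this
      linarith
    · exact haJ i hi
  simp [hau] at ha1

lemma finite_and_even_ncard_iUnion_faceInter (hd : Even d) (hd0 : 0 < d) (hJ : 1 < J.card) :
    (⋃ x ∈ Jᶜ, faceInter d J x).Finite ∧ Even (⋃ x ∈ Jᶜ, faceInter d J x).ncard := by
  set X := Finset.univ.filter fun x => x ∉ J ∧ AlternatesOff J x with hX
  have hne : ∀ x ∈ X, (faceInter d J x).Nonempty := fun x hx => by
    rw [hX, Finset.mem_filter] at hx
    exact faceInter_nonempty hd hd0 (Finset.card_pos.1 (by omega)) hx.2.1 hx.2.2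
  choose! p hp using hne
  have hmem : ∀ x ∈ X, x ∉ J := fun x hx => (Finset.mem_filter.1 hx).2.1
  have himage : (⋃ x ∈ Jᶜ, faceInter d J x) = p '' X := by
    ext z
    simp only [Set.mem_iUnion, Finset.mem_compl, exists_prop, Set.mem_image, Finset.mem_coe]
    constructor
    · rintro ⟨x, hx, hz⟩
      by_cases h : AlternatesOff J x
      · have hxX : x ∈ X := by simp [hX, hx, h]
        exact ⟨x, hxX, faceInter_subsingleton hd hd0 hx (hp x hxX) hz⟩
      · rw [faceInter_eq_empty hd hd0 hx h] at hz
        exact hz.elim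
    · rintro ⟨x, hx, rfl⟩
      exact ⟨x, hmem x hx, hp x hx⟩
  have hinj : Set.InjOn p X := by
    intro x hx y hy hxy
    by_contra hne
    exact Set.disjoint_left.1 (disjoint_faceInter hd0 hJ (hmem x hx) (hmem y hy) hne)
      (hp x hx) (hxy ▸ hp y hy)
  rw [himage, hinj.ncard_image, Set.ncard_coe_finset]
  exact ⟨X.finite_toSet.image p, even_card_alternatesOff hd J⟩

lemma inter_simplexBoundary_eq {m : ℕ} (hd0 : 0 < d) (hJ : Jᶜ.card = m + 1) :
    convexHull ℝ ((J.image (momentPoint d) : Finset _) : Set (Fin d → ℝ)) ∩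
      simplexBoundary d m (Finset.univ.image (momentPoint d) \ J.image (momentPoint d)) =
    ⋃ x ∈ Jᶜ, faceInter d J x := by
  have hf := momentPoint_injective hd0
  rw [← Finset.image_sdiff _ _ hf, ← Finset.compl_eq_univ_sdiff]
  ext z
  simp only [simplexBoundary, faceInter, Set.mem_inter_iff, Set.mem_iUnion, exists_prop,
    Finset.mem_powersetCard]
  constructor
  · rintro ⟨hz, Y, ⟨hY, hYm⟩, hzY⟩
    obtain ⟨U, hU, rfl⟩ := Finset.subset_image_iff.1 hY
    rw [Finset.card_image_of_injective _ hf] at hYm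
    have hU' : U ⊆ Jᶜ := by exact_mod_cast hU
    have hc : (Jᶜ \ U).card = 1 := by
      rw [Finset.card_sdiff_of_subset hU']
      omega
    obtain ⟨x, hx⟩ := Finset.card_eq_one.1 hc
    have hxJ : x ∈ Jᶜ := (Finset.mem_sdiff.1 (hx ▸ Finset.mem_singleton_self x)).1
    refine ⟨x, hxJ, hz, ?_⟩
    rwa [Finset.erase_eq, ← hx, Finset.sdiff_sdiff_eq_self hU']
  · rintro ⟨x, hx, hz, hzx⟩
    refine ⟨hz, _, ⟨Finset.image_subset_image (Finset.erase_subset x _), ?_⟩, hzx⟩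
    rw [Finset.card_image_of_injective _ hf, Finset.card_erase_of_mem hx, hJ, Nat.add_sub_cancel]

end Intersection

theorem stmt2 (k : ℕ) (hk : 1 ≤ k) :
    ∃ S : Finset (Fin (2 * k) → ℝ), S.card = 2 * k + 3 ∧ GenPos (2 * k) S ∧
      ∀ I ⊆ S, I.card = k + 1 →
        (convexHull ℝ (I : Set (Fin (2 * k) → ℝ)) ∩
          simplexBoundary (2 * k) (k + 1) (S \ I)).Finite ∧
        Even (convexHull ℝ (I : Set (Fin (2 * k) → ℝ)) ∩
          simplexBoundary (2 * k) (k + 1) (S \ I)).ncard := by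
  have hd : Even (2 * k) := even_two_mul k
  have hd0 : 0 < 2 * k := by omega
  have hf := momentPoint_injective hd0
  refine ⟨Finset.univ.image (momentPoint (2 * k)), ?_, genPos_momentPoint hd0, ?_⟩
  · rw [Finset.card_image_of_injective _ hf, Finset.card_univ, Fintype.card_fin]
  · intro I hI hcard
    obtain ⟨J, -, rfl⟩ := Finset.subset_image_iff.1 hI
    rw [Finset.card_image_of_injective _ hf] at hcard
    have hJ : Jᶜ.card = k + 1 + 1 := by
      rw [Finset.card_compl, hcard, Fintype.card_fin]
      omega
    rw [inter_simplexBoundary_eq hd0 hJ]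
    exact finite_and_even_ncard_iUnion_faceInter hd hd0 (by omega)
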